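/- arXiv:0903.0641 — 3 statements merged into one kernel-verified Lean document; each statement's English description precedes it below -/
import Mathlib

section
/- The prime two-sided ideals of S_n of height 1 are exactly p_1, …, p_n; these ideals are pairwise distinct and pairwise incomparable, so S_n has exactly n height-one prime ideals. -/
set_option synthInstance.maxHeartbeats 1000000
set_option maxHeartbeats 1000000

open MvPolynomial

noncomputable section

/-- The polynomial algebra `P_n = K[x_1, …, x_n]`. -/
abbrev PolyAlg (K : Type u) [Field K] (n : ℕ) := MvPolynomial (Fin n) K

/-- `X_i` : multiplication by the variable `x_i`, as a `K`-linear endomorphism of `P_n`. -/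
def Xop (K : Type u) [Field K] (n : ℕ) (i : Fin n) : Module.End K (PolyAlg K n) :=
  LinearMap.mulLeft K (X i)

/-- `Y_i` : the left inverse of `X_i`, sending a monomial `x^α` to `x^{α - e_i}` if `α i ≥ 1`
and to `0` otherwise. -/
def Yop (K : Type u) [Field K] (n : ℕ) (i : Fin n) : Module.End K (PolyAlg K n) :=
  (basisMonomials (Fin n) K).constr K fun α =>
    if α i = 0 then 0 else monomial (α - Finsupp.single i 1) (1 : K)

/-- The algebra `S_n` of one-sided inverses of `P_n` : the subalgebra of `End_K(P_n)`
generated by `X_1, …, X_n, Y_1, …, Y_n`. -/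
def SnAlg (K : Type u) [Field K] (n : ℕ) : Subalgebra K (Module.End K (PolyAlg K n)) :=
  Algebra.adjoin K (Set.range (Xop K n) ∪ Set.range (Yop K n))

/-- `x_i` as an element of `S_n`. -/
def xS (K : Type u) [Field K] (n : ℕ) (i : Fin n) : SnAlg K n :=
  ⟨Xop K n i, Algebra.subset_adjoin (Set.mem_union_left _ ⟨i, rfl⟩)⟩

/-- `y_i` as an element of `S_n`. -/
def yS (K : Type u) [Field K] (n : ℕ) (i : Fin n) : SnAlg K n :=
  ⟨Yop K n i, Algebra.subset_adjoin (Set.mem_union_right _ ⟨i, rfl⟩)⟩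

/-- The product `I*J` of two two-sided ideals: the two-sided ideal generated by all products
`a * b` with `a ∈ I`, `b ∈ J`. -/
def tsiMul {R : Type*} [Ring R] (I J : TwoSidedIdeal R) : TwoSidedIdeal R :=
  TwoSidedIdeal.span {x | ∃ a ∈ I, ∃ b ∈ J, x = a * b}

/-- A two-sided ideal `P` of a ring is prime if it is proper and for all two-sided ideals
`I`, `J`, `I*J ⊆ P` implies `I ⊆ P` or `J ⊆ P`. -/
def tsiPrime {R : Type*} [Ring R] (P : TwoSidedIdeal R) : Prop :=
  P ≠ ⊤ ∧ ∀ I J : TwoSidedIdeal R, tsiMul I J ≤ P → I ≤ P ∨ J ≤ P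

/-- There is a strictly increasing chain of prime two-sided ideals
`f 0 ⊊ f 1 ⊊ ⋯ ⊊ f m = P` of length `m` ending at `P`. -/
def primeChainTo {R : Type*} [Ring R] (P : TwoSidedIdeal R) (m : ℕ) : Prop :=
  ∃ f : Fin (m + 1) → TwoSidedIdeal R,
    StrictMono f ∧ (∀ i, tsiPrime (f i)) ∧ f (Fin.last m) = P

/-- There is a strictly increasing chain of prime two-sided ideals
`P = f 0 ⊊ f 1 ⊊ ⋯ ⊊ f m` of length `m` starting at `P`. -/
def primeChainFrom {R : Type*} [Ring R] (P : TwoSidedIdeal R) (m : ℕ) : Prop :=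
  ∃ f : Fin (m + 1) → TwoSidedIdeal R,
    StrictMono f ∧ (∀ i, tsiPrime (f i)) ∧ f 0 = P

/-- The height of the prime two-sided ideal `P` is `h` : there is a chain of primes of length `h`
ending at `P` and every such chain has length at most `h`. -/
def heightIs {R : Type*} [Ring R] (P : TwoSidedIdeal R) (h : ℕ) : Prop :=
  primeChainTo P h ∧ ∀ m, primeChainTo P m → m ≤ h

/-- The co-height of the prime two-sided ideal `P` (the classical Krull dimension of `R/P`) is
`c` : there is a chain of primes of length `c` starting at `P` and every such chain has length
at most `c`. -/
def coheightIs {R : Type*} [Ring R] (P : TwoSidedIdeal R) (c : ℕ) : Prop :=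
  primeChainFrom P c ∧ ∀ m, primeChainFrom P m → m ≤ c

/-- The ideal `p_i` of `S_n`, generated by `1 - x_i y_i`. -/
def pIdeal (K : Type u) [Field K] (n : ℕ) (i : Fin n) : TwoSidedIdeal (SnAlg K n) :=
  TwoSidedIdeal.span {1 - xS K n i * yS K n i}

section TwoSided

variable {R : Type*} [Ring R]

/-- Primeness of a two-sided ideal can be tested on elements. -/
theorem tsiPrime_iff {P : TwoSidedIdeal R} :
    tsiPrime P ↔ P ≠ ⊤ ∧ ∀ a b : R, (∀ s, a * s * b ∈ P) → a ∈ P ∨ b ∈ P := by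
  refine and_congr_right fun _ => ⟨fun h a b hab => ?_, fun h I J hIJ => ?_⟩
  · have h1 : ∀ x ∈ TwoSidedIdeal.span {a}, ∀ s, x * s * b ∈ P := by
      let Q : TwoSidedIdeal R := TwoSidedIdeal.mk' {x | ∀ s, x * s * b ∈ P}
        (by simp [P.zero_mem])
        (fun {x y} hx hy s => by
          rw [add_mul, add_mul]
          exact P.add_mem (hx s) (hy s))
        (fun {x} hx s => by
          rw [neg_mul, neg_mul]
          exact P.neg_mem (hx s))
        (fun {x y} hy s => by
          rw [mul_assoc x, mul_assoc x]
          exact P.mul_mem_left _ _ (hy s))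
        (fun {x y} hx s => by
          rw [mul_assoc x]
          exact hx (y * s))
      intro x hx
      have hQ : x ∈ Q := (TwoSidedIdeal.mem_span_iff.1 hx) Q (by
        rintro _ rfl
        exact (TwoSidedIdeal.mem_mk' _ _ _ _ _ _ _).2 hab)
      exact (TwoSidedIdeal.mem_mk' _ _ _ _ _ _ _).1 hQ
    have h2 : ∀ y ∈ TwoSidedIdeal.span {b}, ∀ x ∈ TwoSidedIdeal.span {a}, x * y ∈ P := by
      let Q : TwoSidedIdeal R := TwoSidedIdeal.mk' {y | ∀ x ∈ TwoSidedIdeal.span {a}, x * y ∈ P}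
        (by simp [P.zero_mem])
        (fun {y z} hy hz x hx => by
          rw [mul_add]
          exact P.add_mem (hy x hx) (hz x hx))
        (fun {y} hy x hx => by
          rw [mul_neg]
          exact P.neg_mem (hy x hx))
        (fun {r y} hy x hx => by
          rw [← mul_assoc]
          exact hy _ (TwoSidedIdeal.mul_mem_right _ _ _ hx))
        (fun {y r} hy x hx => by
          rw [← mul_assoc]
          exact P.mul_mem_right _ _ (hy x hx))
      intro y hy
      have hQ : y ∈ Q := (TwoSidedIdeal.mem_span_iff.1 hy) Q (by
        rintro _ rfl
        refine (TwoSidedIdeal.mem_mk' _ _ _ _ _ _ _).2 fun x hx => ?_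
        simpa using h1 x hx 1)
      exact (TwoSidedIdeal.mem_mk' _ _ _ _ _ _ _).1 hQ
    have h3 : tsiMul (TwoSidedIdeal.span {a}) (TwoSidedIdeal.span {b}) ≤ P := by
      refine TwoSidedIdeal.span_le.2 ?_
      rintro _ ⟨x, hx, y, hy, rfl⟩
      exact h2 y hy x hx
    exact (h _ _ h3).imp (fun h' => h' (TwoSidedIdeal.subset_span rfl))
      (fun h' => h' (TwoSidedIdeal.subset_span rfl))
  · by_contra! hcon
    obtain ⟨a, haI, ha⟩ := Set.not_subset.1 hcon.1
    obtain ⟨b, hbJ, hb⟩ := Set.not_subset.1 hcon.2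
    refine (h a b fun s => hIJ (TwoSidedIdeal.subset_span ?_)).elim ha hb
    exact ⟨a * s, I.mul_mem_right _ _ haI, b, hbJ, rfl⟩

theorem one_notMem_of_ne_top {P : TwoSidedIdeal R} (h : P ≠ ⊤) : (1 : R) ∉ P := fun h1 =>
  h <| top_unique fun x _ => by simpa using P.mul_mem_left x 1 h1

/-- A prime lying strictly above the zero ideal, with the zero ideal prime and no prime strictly in
between, has height one. -/
theorem heightIs_one {P : TwoSidedIdeal R} (h0 : tsiPrime (⊥ : TwoSidedIdeal R)) (hP : tsiPrime P)
    (hne : ⊥ < P) (hmin : ∀ Q, tsiPrime Q → Q < P → Q = ⊥) : heightIs P 1 := by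
  refine ⟨⟨![⊥, P], ?_, ?_, rfl⟩, ?_⟩
  · intro i j hij
    fin_cases i <;> fin_cases j <;> simp_all
  · intro i
    fin_cases i
    exacts [h0, hP]
  · rintro m ⟨f, hf, hfp, rfl⟩
    by_contra! hm
    have h1 : f ⟨1, by omega⟩ = ⊥ := hmin _ (hfp _) (hf (by simp [Fin.lt_def]; omega))
    have h2 : f 0 < f ⟨1, by omega⟩ := hf (by simp [Fin.lt_def])
    exact not_lt_bot (h1 ▸ h2)

theorem eq_of_heightIs_one {P Q : TwoSidedIdeal R} (h0 : tsiPrime (⊥ : TwoSidedIdeal R))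
    (hQ : tsiPrime Q) (hne : ⊥ < Q) (hP : tsiPrime P) (hQP : Q ≤ P) (h : heightIs P 1) :
    P = Q := by
  by_contra hcon
  have hlt : Q < P := lt_of_le_of_ne hQP (Ne.symm hcon)
  have := h.2 2 ⟨![⊥, Q, P], ?_, ?_, rfl⟩
  · omega
  · intro i j hij
    have := hne.trans hlt
    fin_cases i <;> fin_cases j <;> simp_all
  · intro i
    fin_cases i
    exacts [h0, hQ, hP]

theorem commute_one_sub_mul {x y u : R} (hx : Commute x u) (hy : Commute y u) :
    Commute (1 - x * y) u :=
  (Commute.one_left u).sub_left (hx.mul_left hy)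

namespace TwoSidedIdeal

variable (P : TwoSidedIdeal R) {x : R}

theorem clear_of_commute {a : R} (ha : Commute a x) :
    ∃ (N : ℕ) (b : R), Commute b x ∧ a * x ^ N - b ∈ P :=
  ⟨0, a, ha, by simp [P.zero_mem]⟩

theorem clear_of_leftInverse {y : R} (h : y * x = 1) :
    ∃ (N : ℕ) (b : R), Commute b x ∧ y * x ^ N - b ∈ P :=
  ⟨1, 1, Commute.one_left _, by simp [h, P.zero_mem]⟩

theorem clear_add {a b : R} (ha : ∃ (N : ℕ) (c : R), Commute c x ∧ a * x ^ N - c ∈ P)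
    (hb : ∃ (N : ℕ) (c : R), Commute c x ∧ b * x ^ N - c ∈ P) :
    ∃ (N : ℕ) (c : R), Commute c x ∧ (a + b) * x ^ N - c ∈ P := by
  obtain ⟨N, c, hc, hac⟩ := ha
  obtain ⟨M, d, hd, hbd⟩ := hb
  refine ⟨N + M, c * x ^ M + d * x ^ N,
    (hc.mul_left (Commute.pow_self _ _)).add_left (hd.mul_left (Commute.pow_self _ _)), ?_⟩
  have : (a + b) * x ^ (N + M) - (c * x ^ M + d * x ^ N) =
      (a * x ^ N - c) * x ^ M + (b * x ^ M - d) * x ^ N := by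
    have h2 : b * x ^ (N + M) = b * x ^ M * x ^ N := by
      rw [add_comm, pow_add, mul_assoc]
    rw [add_mul, h2, pow_add, sub_mul, sub_mul, mul_assoc a]
    abel
  rw [this]
  exact P.add_mem (P.mul_mem_right _ _ hac) (P.mul_mem_right _ _ hbd)

theorem clear_mul {a b : R} (ha : ∃ (N : ℕ) (c : R), Commute c x ∧ a * x ^ N - c ∈ P)
    (hb : ∃ (N : ℕ) (c : R), Commute c x ∧ b * x ^ N - c ∈ P) :
    ∃ (N : ℕ) (c : R), Commute c x ∧ a * b * x ^ N - c ∈ P := by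
  obtain ⟨N, c, hc, hac⟩ := ha
  obtain ⟨M, d, hd, hbd⟩ := hb
  refine ⟨M + N, c * d, hc.mul_left hd, ?_⟩
  have h1 : d * x ^ N = x ^ N * d := (hd.pow_right N).eq
  have : a * b * x ^ (M + N) - c * d =
      a * ((b * x ^ M - d) * x ^ N) + (a * x ^ N - c) * d := by
    rw [sub_mul, sub_mul, mul_sub, h1, pow_add]
    simp only [mul_assoc]
    abel
  rw [this]
  exact P.add_mem (P.mul_mem_left _ _ (P.mul_mem_right _ _ hbd)) (P.mul_mem_right _ _ hac)

variable {P}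

theorem mem_of_mul_pow_mem {y : R} (h : 1 - x * y ∈ P) {a : R} {N : ℕ} (ha : a * x ^ N ∈ P) :
    a ∈ P := by
  induction N with
  | zero => simpa using ha
  | succ N ih =>
    refine ih ?_
    have : a * x ^ N = a * x ^ N * (1 - x * y) + a * x ^ (N + 1) * y := by
      rw [mul_sub, pow_succ]
      simp only [mul_assoc, mul_one]
      abel
    rw [this]
    exact P.add_mem (P.mul_mem_left _ _ h) (P.mul_mem_right _ _ ha)

variable (P)

theorem ne_zero_of_mul_pow_sub_mem {y : R} (h : 1 - x * y ∈ P) {a c : R} {N : ℕ} (ha : a ∉ P)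
    (hac : a * x ^ N - c ∈ P) : c ≠ 0 := by
  rintro rfl
  exact ha (mem_of_mul_pow_mem h (by simpa using hac))

theorem mul_mul_mem_of_sub_mem {a b c d u v s : R} (hac : a * u - c ∈ P) (hbd : b * v - d ∈ P)
    (h : a * (u * s) * b ∈ P) : c * s * d ∈ P := by
  have : c * s * d = a * (u * s) * b * v -
      ((a * u - c) * (s * b * v) + c * s * (b * v - d)) := by
    simp only [mul_sub, sub_mul, mul_assoc]
    abel
  rw [this]
  exact P.sub_mem (P.mul_mem_right _ _ h)
    (P.add_mem (P.mul_mem_right _ _ hac) (P.mul_mem_left _ _ hbd))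

end TwoSidedIdeal

end TwoSided

section OneSidedInverses

variable {K : Type*} [Field K] {n : ℕ}

theorem SnAlg.induction {p : SnAlg K n → Prop} (hx : ∀ i, p (xS K n i)) (hy : ∀ i, p (yS K n i))
    (hc : ∀ c, p (algebraMap K _ c)) (hadd : ∀ a b, p a → p b → p (a + b))
    (hmul : ∀ a b, p a → p b → p (a * b)) (a : SnAlg K n) : p a := by
  obtain ⟨a, ha⟩ := a
  refine Algebra.adjoin_induction (p := fun a ha => p ⟨a, ha⟩) ?_ hc
    (fun a b ha hb => hadd ⟨a, ha⟩ ⟨b, hb⟩) (fun a b ha hb => hmul ⟨a, ha⟩ ⟨b, hb⟩) ha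
  rintro _ (⟨i, rfl⟩ | ⟨i, rfl⟩)
  exacts [hx i, hy i]

theorem SnAlg.ext_coeff {a b : SnAlg K n} (h : ∀ α f, coeff α (a.1 f) = coeff α (b.1 f)) :
    a = b :=
  Subtype.ext <| LinearMap.ext fun f => MvPolynomial.ext _ _ fun α => h α f

theorem SnAlg.mul_apply (a b : SnAlg K n) (f : PolyAlg K n) : (a * b).1 f = a.1 (b.1 f) := rfl

theorem xS_apply (i : Fin n) (f : PolyAlg K n) : (xS K n i).1 f = X i * f := rfl

theorem coeff_xS (i : Fin n) (α : Fin n →₀ ℕ) (f : PolyAlg K n) :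
    coeff α ((xS K n i).1 f) = if α i = 0 then 0 else coeff (α - Finsupp.single i 1) f := by
  rw [xS_apply, coeff_X_mul']
  by_cases h : α i = 0 <;> simp [h]

theorem coeff_yS (i : Fin n) (α : Fin n →₀ ℕ) (f : PolyAlg K n) :
    coeff α ((yS K n i).1 f) = coeff (α + Finsupp.single i 1) f := by
  have : lcoeff K α ∘ₗ (yS K n i).1 = lcoeff K (α + Finsupp.single i 1) := by
    refine (basisMonomials (Fin n) K).ext fun β => ?_
    have h1 : (yS K n i).1 (basisMonomials (Fin n) K β) =
      if β i = 0 then 0 else monomial (β - Finsupp.single i 1) (1 : K) :=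
        (basisMonomials (Fin n) K).constr_basis K _ β
    rw [LinearMap.comp_apply, h1, coe_basisMonomials, lcoeff_apply, lcoeff_apply, coeff_monomial]
    by_cases h : β i = 0
    · rw [if_pos h, if_neg, coeff_zero]
      rintro rfl
      simp at h
    · rw [if_neg h, coeff_monomial]
      have : β - Finsupp.single i 1 = α ↔ β = α + Finsupp.single i 1 :=
        tsub_eq_iff_eq_add_of_le (by simpa [Nat.one_le_iff_ne_zero] using h)
      simp only [this]
  exact LinearMap.congr_fun this f

/-- The idempotent `1 - x_i y_i`. -/
def idemS (K : Type*) [Field K] (n : ℕ) (i : Fin n) : SnAlg K n := 1 - xS K n i * yS K n i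

theorem coeff_idemS (i : Fin n) (α : Fin n →₀ ℕ) (f : PolyAlg K n) :
    coeff α ((idemS K n i).1 f) = if α i = 0 then coeff α f else 0 := by
  have : (idemS K n i).1 f = f - (xS K n i).1 ((yS K n i).1 f) := rfl
  rw [this, coeff_sub, coeff_xS]
  by_cases h : α i = 0
  · simp [h]
  · rw [if_neg h, if_neg h, coeff_yS, tsub_add_cancel_of_le, sub_self]
    simpa [Nat.one_le_iff_ne_zero] using h

theorem yS_mul_xS (i : Fin n) : yS K n i * xS K n i = 1 := by
  refine SnAlg.ext_coeff fun α f => ?_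
  rw [SnAlg.mul_apply, coeff_yS, coeff_xS]
  simp

theorem xS_commute_xS (i j : Fin n) : Commute (xS K n i) (xS K n j) := by
  refine Subtype.ext <| LinearMap.ext fun f => ?_
  exact mul_left_comm (X i) (X j) f

theorem yS_commute_yS (i j : Fin n) : Commute (yS K n i) (yS K n j) := by
  refine SnAlg.ext_coeff fun α f => ?_
  simp only [SnAlg.mul_apply, coeff_yS, add_right_comm]

theorem xS_commute_yS {i j : Fin n} (h : i ≠ j) : Commute (xS K n i) (yS K n j) := by
  refine SnAlg.ext_coeff fun α f => ?_
  simp only [SnAlg.mul_apply, coeff_yS, coeff_xS, Finsupp.add_apply, Finsupp.single_eq_of_ne h,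
    add_zero]
  by_cases hα : α i = 0
  · simp [hα]
  · rw [if_neg hα, if_neg hα, tsub_add_eq_add_tsub]
    simpa [Nat.one_le_iff_ne_zero] using hα

/-- `a` acts as the projection onto the span of the monomials not involving the `x_j`, `j ∈ U`. -/
def IsProj (U : Finset (Fin n)) (a : SnAlg K n) : Prop :=
  ∀ α f, coeff α (a.1 f) = if ∀ j ∈ U, α j = 0 then coeff α f else 0

theorem IsProj.insert {U : Finset (Fin n)} {a : SnAlg K n} (ha : IsProj U a) (i : Fin n) :
    IsProj (insert i U) (idemS K n i * a) := by
  intro α f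
  rw [SnAlg.mul_apply, coeff_idemS, ha]
  by_cases h : α i = 0 <;> simp [h]

theorem exists_isProj (U : Finset (Fin n)) : ∃ a : SnAlg K n, IsProj U a := by
  induction U using Finset.induction_on with
  | empty => exact ⟨1, fun α f => by simp⟩
  | insert i U _ ih =>
    obtain ⟨a, ha⟩ := ih
    exact ⟨_, ha.insert i⟩

theorem IsProj.eq {U : Finset (Fin n)} {a b : SnAlg K n} (ha : IsProj U a) (hb : IsProj U b) :
    a = b :=
  SnAlg.ext_coeff fun α f => by rw [ha, hb]

theorem IsProj.commute_xS {U : Finset (Fin n)} {a : SnAlg K n} (ha : IsProj U a) {i : Fin n}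
    (hi : i ∉ U) : Commute a (xS K n i) := by
  refine SnAlg.ext_coeff fun α f => ?_
  have h : (∀ j ∈ U, (α - Finsupp.single i 1 : Fin n →₀ ℕ) j = 0) ↔ ∀ j ∈ U, α j = 0 :=
    forall₂_congr fun j hj => by
      rw [Finsupp.tsub_apply, Finsupp.single_eq_of_ne (ne_of_mem_of_not_mem hj hi), tsub_zero]
  simp only [SnAlg.mul_apply, ha _ _, coeff_xS, h]
  split_ifs <;> rfl

theorem IsProj.commute_yS {U : Finset (Fin n)} {a : SnAlg K n} (ha : IsProj U a) {i : Fin n}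
    (hi : i ∉ U) : Commute a (yS K n i) := by
  refine SnAlg.ext_coeff fun α f => ?_
  have h : (∀ j ∈ U, (α + Finsupp.single i 1 : Fin n →₀ ℕ) j = 0) ↔ ∀ j ∈ U, α j = 0 :=
    forall₂_congr fun j hj => by
      rw [Finsupp.add_apply, Finsupp.single_eq_of_ne (ne_of_mem_of_not_mem hj hi), add_zero]
  simp only [SnAlg.mul_apply, ha _ _, coeff_yS, h]

/-- The monomial `y^β` belongs to `S_n`; it is described by its action on coefficients. -/
theorem exists_yMonomial (β : Fin n →₀ ℕ) :
    ∃ a : SnAlg K n, ∀ α f, coeff α (a.1 f) = coeff (α + β) f := by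
  induction β using Finsupp.induction_linear with
  | zero => exact ⟨1, fun α f => by simp⟩
  | add β γ hβ hγ =>
    obtain ⟨a, ha⟩ := hβ
    obtain ⟨b, hb⟩ := hγ
    exact ⟨a * b, fun α f => by rw [SnAlg.mul_apply, ha, hb, add_assoc]⟩
  | single i k =>
    induction k with
    | zero => exact ⟨1, fun α f => by simp⟩
    | succ k ih =>
      obtain ⟨a, ha⟩ := ih
      refine ⟨a * yS K n i, fun α f => ?_⟩
      rw [SnAlg.mul_apply, ha, coeff_yS, Finsupp.single_add, add_assoc]

/-- Every polynomial acts on `P_n` by multiplication through an element of `S_n`. -/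
theorem exists_mulLeft (g : PolyAlg K n) : ∃ a : SnAlg K n, ∀ f, a.1 f = g * f := by
  induction g using MvPolynomial.induction_on with
  | C c => exact ⟨algebraMap K _ c, fun f => by rw [← MvPolynomial.smul_eq_C_mul]; rfl⟩
  | add p q hp hq =>
    obtain ⟨a, ha⟩ := hp
    obtain ⟨b, hb⟩ := hq
    exact ⟨a + b, fun f => by rw [add_mul, ← ha, ← hb]; rfl⟩
  | mul_X p i hp =>
    obtain ⟨a, ha⟩ := hp
    exact ⟨a * xS K n i, fun f => by rw [SnAlg.mul_apply, ha, xS_apply, mul_assoc]⟩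

theorem apply_X_pow_mul_of_commute {i : Fin n} {b : SnAlg K n} (hb : Commute b (xS K n i)) (m : ℕ)
    (f : PolyAlg K n) : b.1 (X i ^ m * f) = X i ^ m * b.1 f := by
  induction m generalizing f with
  | zero => rw [pow_zero, one_mul, one_mul]
  | succ m ih =>
    have h : b.1 (X i * f) = X i * b.1 f := congrArg (fun a : SnAlg K n => a.1 f) hb.eq
    rw [pow_succ, mul_assoc, mul_assoc, ih, h]

/-- Elements commuting with some of the `x_i` are linear over the polynomials in these `x_i`. -/
theorem apply_mul_of_commute {U : Set (Fin n)} {b : SnAlg K n}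
    (hb : ∀ i ∈ U, Commute b (xS K n i)) {q : PolyAlg K n} (hq : q ∈ supported K U)
    (f : PolyAlg K n) : b.1 (q * f) = q * b.1 f := by
  rw [supported] at hq
  induction hq using Algebra.adjoin_induction generalizing f with
  | mem x hx =>
    obtain ⟨i, hi, rfl⟩ := hx
    have := congrArg (fun a : SnAlg K n => a.1 f) (hb i hi).eq
    exact this
  | algebraMap c =>
    rw [← Algebra.smul_def, ← Algebra.smul_def, map_smul]
  | add x y _ _ hx hy => rw [add_mul, map_add, hx, hy, add_mul]
  | mul x y _ _ hx hy => rw [mul_assoc, hx, hy, mul_assoc]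

theorem mem_supported_of_coeff {U : Set (Fin n)} {q : PolyAlg K n}
    (h : ∀ α, coeff α q ≠ 0 → ∀ i, α i ≠ 0 → i ∈ U) : q ∈ supported K U := by
  rw [mem_supported]
  intro i hi
  obtain ⟨d, hd, hid⟩ := (MvPolynomial.mem_vars_iff_mem_support i).1 hi
  exact h d (mem_support_iff.1 hd) i (Finsupp.mem_support_iff.1 hid)

theorem exists_apply_eq_mul (U : Finset (Fin n)) {h : PolyAlg K n} (hh : h ≠ 0)
    (g : PolyAlg K n) : ∃ s : SnAlg K n, (∀ i ∉ U, Commute s (xS K n i)) ∧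
      ∃ q ∈ supported K {i | i ∉ U}, q ≠ 0 ∧ s.1 h = g * q := by
  classical
  obtain ⟨δ, hδ⟩ := MvPolynomial.ne_zero_iff.1 hh
  obtain ⟨e, he⟩ := exists_isProj (K := K) U
  obtain ⟨y, hy⟩ := exists_yMonomial (K := K) (δ.filter (· ∈ U))
  obtain ⟨m, hm⟩ := exists_mulLeft g
  refine ⟨m * (e * y), fun i hi => ?_, e.1 (y.1 h), ?_, ?_, hm _⟩
  · have hmi : Commute m (xS K n i) := by
      refine Subtype.ext <| LinearMap.ext fun f => ?_
      change m.1 (X i * f) = X i * m.1 f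
      rw [hm, hm, mul_left_comm]
    have hyi : Commute y (xS K n i) := by
      refine SnAlg.ext_coeff fun α f => ?_
      have hz : (α + δ.filter (· ∈ U)) i = α i := by simp [hi]
      simp only [SnAlg.mul_apply, hy, coeff_xS, hz]
      by_cases hα : α i = 0
      · simp [hα]
      · rw [if_neg hα, if_neg hα, tsub_add_eq_add_tsub]
        simpa [Nat.one_le_iff_ne_zero] using hα
    exact hmi.mul_left ((he.commute_xS hi).mul_left hyi)
  · refine mem_supported_of_coeff fun α hα i hi hiU => ?_
    rw [he] at hα
    exact hα (if_neg fun h => hi (h i hiU))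
  · refine MvPolynomial.ne_zero_iff.2 ⟨δ.filter (· ∉ U), ?_⟩
    rw [he, if_pos (fun j hj => by simp [hj]), hy, add_comm, Finsupp.filter_add_filter_not]
    exact hδ

theorem exists_mul_mul_ne_zero {U : Finset (Fin n)} {b d : SnAlg K n} (hb0 : b ≠ 0) (hd0 : d ≠ 0)
    (hb : ∀ i ∉ U, Commute b (xS K n i)) :
    ∃ s : SnAlg K n, (∀ i ∉ U, Commute s (xS K n i)) ∧ b * s * d ≠ 0 := by
  have key : ∀ a : SnAlg K n, a ≠ 0 → ∃ f, a.1 f ≠ 0 := fun a ha => by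
    by_contra! hcon
    exact ha (Subtype.ext (LinearMap.ext hcon))
  obtain ⟨f, hf⟩ := key d hd0
  obtain ⟨g, hg⟩ := key b hb0
  obtain ⟨s, hs, q, hq, hq0, hsq⟩ := exists_apply_eq_mul U hf g
  refine ⟨s, hs, fun h => ?_⟩
  have h1 : b.1 (s.1 (d.1 f)) = 0 := congrArg (fun a : SnAlg K n => a.1 f) h
  rw [hsq, mul_comm, apply_mul_of_commute hb hq] at h1
  exact (mul_ne_zero hq0 hg) h1

theorem tsiPrime_bot : tsiPrime (⊥ : TwoSidedIdeal (SnAlg K n)) := by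
  refine tsiPrime_iff.2 ⟨fun h => ?_, fun a b hab => ?_⟩
  · have : (1 : SnAlg K n) ∈ (⊥ : TwoSidedIdeal (SnAlg K n)) := h ▸ trivial
    exact one_ne_zero this
  · by_contra! hcon
    obtain ⟨s, -, hs⟩ := exists_mul_mul_ne_zero (U := Finset.univ)
      (b := a) (d := b) hcon.1 hcon.2 (by simp)
    exact hs (hab s)

/-- An element of `p_i` kills `x_i^m f` for all sufficiently large `m`. -/
theorem eventually_zero_of_mem_pIdeal {i : Fin n} {a : SnAlg K n} (ha : a ∈ pIdeal K n i)
    (f : PolyAlg K n) : ∃ N, ∀ m ≥ N, a.1 (X i ^ m * f) = 0 := by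
  let p : SnAlg K n → Prop := fun a => ∀ f, ∃ N, ∀ m ≥ N, a.1 (X i ^ m * f) = 0
  have hadd : ∀ a b, p a → p b → p (a + b) := fun a b ha hb f => by
    obtain ⟨N, hN⟩ := ha f
    obtain ⟨M, hM⟩ := hb f
    refine ⟨max N M, fun m hm => ?_⟩
    have : (a + b).1 (X i ^ m * f) = a.1 (X i ^ m * f) + b.1 (X i ^ m * f) := rfl
    rw [this, hN m (le_of_max_le_left hm), hM m (le_of_max_le_right hm), add_zero]
  have hmulr : ∀ b : SnAlg K n, ∀ a, p a → p (a * b) := by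
    refine SnAlg.induction (fun j a ha f => ?_) (fun j a ha f => ?_) (fun c a ha f => ?_)
      (fun b c hb hc a ha => ?_) (fun b c hb hc a ha => ?_)
    · obtain ⟨N, hN⟩ := ha (X j * f)
      refine ⟨N, fun m hm => ?_⟩
      rw [SnAlg.mul_apply, xS_apply, mul_left_comm]
      exact hN m hm
    · by_cases hij : i = j
      · subst hij
        obtain ⟨N, hN⟩ := ha f
        refine ⟨N + 1, fun m hm => ?_⟩
        obtain ⟨m, rfl⟩ : ∃ k, m = k + 1 := ⟨m - 1, by omega⟩
        have : (yS K n i).1 (X i ^ (m + 1) * f) = X i ^ m * f := by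
          rw [pow_succ', mul_assoc, ← xS_apply, ← SnAlg.mul_apply, yS_mul_xS]
          rfl
        rw [SnAlg.mul_apply, this]
        exact hN m (by omega)
      · obtain ⟨N, hN⟩ := ha ((yS K n j).1 f)
        refine ⟨N, fun m hm => ?_⟩
        rw [SnAlg.mul_apply, apply_X_pow_mul_of_commute (xS_commute_yS hij).symm]
        exact hN m hm
    · obtain ⟨N, hN⟩ := ha f
      refine ⟨N, fun m hm => ?_⟩
      have : (a * algebraMap K (SnAlg K n) c).1 (X i ^ m * f) = a.1 (c • (X i ^ m * f)) := rfl
      rw [this, map_smul, hN m hm, smul_zero]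
    · rw [mul_add]
      exact hadd _ _ (hb a ha) (hc a ha)
    · rw [← mul_assoc]
      exact hc _ (hb a ha)
  let Q : TwoSidedIdeal (SnAlg K n) := TwoSidedIdeal.mk' {a | p a}
    (fun f => ⟨0, fun m _ => rfl⟩) (fun {a b} => hadd a b)
    (fun {a} ha f => by
      obtain ⟨N, hN⟩ := ha f
      refine ⟨N, fun m hm => ?_⟩
      have : (-a).1 (X i ^ m * f) = -a.1 (X i ^ m * f) := rfl
      rw [this, hN m hm, neg_zero])
    (fun {a b} hb f => by
      obtain ⟨N, hN⟩ := hb f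
      exact ⟨N, fun m hm => by rw [SnAlg.mul_apply, hN m hm, map_zero]⟩)
    (fun {a b} ha => hmulr b a ha)
  have hQ : a ∈ Q := (TwoSidedIdeal.mem_span_iff.1 ha) Q (by
    rintro _ rfl
    refine (TwoSidedIdeal.mem_mk' _ _ _ _ _ _ _).2 fun f => ⟨1, fun m hm => ?_⟩
    obtain ⟨m, rfl⟩ : ∃ k, m = k + 1 := ⟨m - 1, by omega⟩
    refine MvPolynomial.ext _ _ fun α => ?_
    refine (coeff_idemS i α _).trans ?_
    rw [pow_succ', mul_assoc, coeff_X_mul']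
    by_cases h : α i = 0 <;> simp [h])
  exact (TwoSidedIdeal.mem_mk' _ _ _ _ _ _ _).1 hQ f

theorem idemS_mem_pIdeal (i : Fin n) : idemS K n i ∈ pIdeal K n i :=
  TwoSidedIdeal.subset_span rfl

theorem idemS_notMem_pIdeal {i j : Fin n} (h : i ≠ j) : idemS K n i ∉ pIdeal K n j := fun hm => by
  obtain ⟨N, hN⟩ := eventually_zero_of_mem_pIdeal hm 1
  have := congrArg (coeff (Finsupp.single j N)) (hN N le_rfl)
  rw [coeff_idemS, if_pos (Finsupp.single_eq_of_ne h), mul_one, coeff_X_pow] at this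
  simp at this

/-- An element of `p_i` commuting with `x_i` vanishes. -/
theorem eq_zero_of_mem_pIdeal {i : Fin n} {a : SnAlg K n} (ha : a ∈ pIdeal K n i)
    (hc : Commute a (xS K n i)) : a = 0 := by
  refine Subtype.ext <| LinearMap.ext fun f => ?_
  obtain ⟨N, hN⟩ := eventually_zero_of_mem_pIdeal ha f
  have := hN N le_rfl
  rw [apply_X_pow_mul_of_commute hc] at this
  exact (mul_eq_zero.1 this).resolve_left (pow_ne_zero _ (X_ne_zero i))

/-- Modulo `p_i`, every element becomes an element commuting with `x_i` after clearing the
denominators `x_i^N`. -/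
theorem exists_commute_sub_mem (i : Fin n) (a : SnAlg K n) : ∃ (N : ℕ) (b : SnAlg K n),
    Commute b (xS K n i) ∧ a * xS K n i ^ N - b ∈ pIdeal K n i := by
  have triv (a : SnAlg K n) (ha : Commute a (xS K n i)) := (pIdeal K n i).clear_of_commute ha
  refine SnAlg.induction (p := fun a => ∃ (N : ℕ) (b : SnAlg K n),
    Commute b (xS K n i) ∧ a * xS K n i ^ N - b ∈ pIdeal K n i)
    (fun j => triv _ (xS_commute_xS j i)) (fun j => ?_)
    (fun c => triv _ (Algebra.commutes c (xS K n i)))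
    (fun _ _ => (pIdeal K n i).clear_add) (fun _ _ => (pIdeal K n i).clear_mul) a
  by_cases hij : i = j
  · subst hij
    exact (pIdeal K n i).clear_of_leftInverse (yS_mul_xS i)
  · exact triv _ (xS_commute_yS hij).symm

theorem tsiPrime_pIdeal (i : Fin n) : tsiPrime (pIdeal K n i) := by
  refine tsiPrime_iff.2 ⟨fun h => ?_, fun a b hab => ?_⟩
  · have h1 : (1 : SnAlg K n) ∈ pIdeal K n i := h ▸ trivial
    exact one_ne_zero (eq_zero_of_mem_pIdeal h1 (Commute.one_left _))
  · by_contra! hcon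
    set P := pIdeal K n i
    obtain ⟨N, c, hc, hac⟩ := exists_commute_sub_mem i a
    obtain ⟨M, d, hd, hbd⟩ := exists_commute_sub_mem i b
    have he : 1 - xS K n i * yS K n i ∈ P := idemS_mem_pIdeal i
    have hc0 : c ≠ 0 := P.ne_zero_of_mul_pow_sub_mem he hcon.1 hac
    have hd0 : d ≠ 0 := P.ne_zero_of_mul_pow_sub_mem he hcon.2 hbd
    have hU : ∀ j ∉ Finset.univ.erase i, j = i := by simp
    obtain ⟨s, hs, hne⟩ := exists_mul_mul_ne_zero (U := Finset.univ.erase i) hc0 hd0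
      (fun j hj => hU j hj ▸ hc)
    refine hne (eq_zero_of_mem_pIdeal (i := i) ?_ ((hc.mul_left (hs i (by simp))).mul_left hd))
    exact P.mul_mul_mem_of_sub_mem hac hbd (hab _)

theorem isProj_univ_mem {P : TwoSidedIdeal (SnAlg K n)} (hP : P ≠ ⊥) {e : SnAlg K n}
    (he : IsProj Finset.univ e) : e ∈ P := by
  obtain ⟨a, haP, ha⟩ : ∃ a ∈ P, a ≠ 0 := by
    by_contra! hcon
    exact hP (bot_unique fun a ha => hcon a ha)
  obtain ⟨α, hα⟩ : ∃ α, a.1 (monomial α 1) ≠ 0 := by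
    by_contra! hcon
    exact ha (Subtype.ext ((basisMonomials (Fin n) K).ext fun α => by simpa using hcon α))
  obtain ⟨β, hβ⟩ := MvPolynomial.ne_zero_iff.1 hα
  obtain ⟨y, hy⟩ := exists_yMonomial (K := K) β
  obtain ⟨m, hm⟩ := exists_mulLeft (monomial α (1 : K))
  have hproj : ∀ f, e.1 f = C (coeff 0 f) := fun f => MvPolynomial.ext _ _ fun γ => by
    rw [he, coeff_C]
    by_cases h : γ = 0
    · simp [h]
    · rw [if_neg, if_neg (Ne.symm h)]
      exact fun h' => h (Finsupp.ext fun j => h' j (Finset.mem_univ j))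
  set c := coeff β (a.1 (monomial α 1))
  have key : e = algebraMap K _ c⁻¹ * (e * y * a * (m * e)) := by
    refine Subtype.ext <| LinearMap.ext fun f => ?_
    change e.1 f = c⁻¹ • e.1 (y.1 (a.1 (m.1 (e.1 f))))
    rw [hproj (y.1 _), hy, hm, hproj f, mul_comm, ← smul_eq_C_mul, map_smul, coeff_smul, zero_add]
    rw [MvPolynomial.smul_eq_C_mul, ← C_mul, smul_eq_mul, mul_comm (coeff 0 f),
      inv_mul_cancel_left₀ hβ]
  rw [key]
  exact P.mul_mem_left _ _ (P.mul_mem_right _ _ (P.mul_mem_left _ _ haP))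

/-- Every element is a sum of products `u * v` with `v` in the subalgebra generated by `x_i, y_i`
and `u` in its centralizer. -/
theorem mem_centralizer_mul_adjoin (i : Fin n) (a : SnAlg K n) :
    a ∈ Subalgebra.toSubmodule (Subalgebra.centralizer K {xS K n i, yS K n i}) *
      Subalgebra.toSubmodule (Algebra.adjoin K {xS K n i, yS K n i}) := by
  set A := Subalgebra.centralizer K {xS K n i, yS K n i}
  set B := Algebra.adjoin K {xS K n i, yS K n i}
  set M := Subalgebra.toSubmodule A * Subalgebra.toSubmodule B
  have hA : ∀ u ∈ A, ∀ m ∈ M, u * m ∈ M := fun u hu m hm => by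
    refine Submodule.mul_induction_on hm (fun p hp q hq => ?_) (fun p q hp hq => ?_)
    · rw [← mul_assoc]
      exact Submodule.mul_mem_mul (A.mul_mem hu hp) hq
    · rw [mul_add]
      exact M.add_mem hp hq
  have hB : ∀ v ∈ ({xS K n i, yS K n i} : Set (SnAlg K n)), ∀ m ∈ M, v * m ∈ M :=
      fun v hv m hm => by
    refine Submodule.mul_induction_on hm (fun p hp q hq => ?_) (fun p q hp hq => ?_)
    · rw [← mul_assoc, (Subalgebra.mem_centralizer_iff K).1 hp v hv, mul_assoc]
      exact Submodule.mul_mem_mul hp (B.mul_mem (Algebra.subset_adjoin hv) hq)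
    · rw [mul_add]
      exact M.add_mem hp hq
  have hM : ∀ m ∈ M, a * m ∈ M := by
    refine SnAlg.induction (p := fun a => ∀ m ∈ M, a * m ∈ M)
      (fun j => ?_) (fun j => ?_) (fun c => hA _ (A.algebraMap_mem c))
      (fun a b ha hb m hm => ?_) (fun a b ha hb m hm => ?_) a
    · by_cases h : j = i
      · exact hB _ (by simp [h])
      · refine hA _ ((Subalgebra.mem_centralizer_iff K).2 ?_)
        rintro _ (rfl | rfl)
        exacts [xS_commute_xS i j, (xS_commute_yS h).symm]
    · by_cases h : j = i
      · exact hB _ (by simp [h])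
      · refine hA _ ((Subalgebra.mem_centralizer_iff K).2 ?_)
        rintro _ (rfl | rfl)
        exacts [xS_commute_yS (Ne.symm h), yS_commute_yS i j]
    · rw [add_mul]
      exact M.add_mem (ha m hm) (hb m hm)
    · rw [mul_assoc]
      exact ha _ (hb m hm)
  have h1 : (1 : SnAlg K n) ∈ M := by
    simpa using Submodule.mul_mem_mul (M := Subalgebra.toSubmodule A)
      (N := Subalgebra.toSubmodule B) A.one_mem B.one_mem
  simpa using hM 1 h1

theorem exists_idemS_mem {P : TwoSidedIdeal (SnAlg K n)} (hP : tsiPrime P) (U : Finset (Fin n))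
    {e : SnAlg K n} (he : IsProj U e) (heP : e ∈ P) : ∃ i, idemS K n i ∈ P := by
  induction U using Finset.induction_on generalizing e with
  | empty =>
    have : e = 1 := he.eq fun α f => by simp
    exact absurd (this ▸ heP) (one_notMem_of_ne_top hP.1)
  | insert i U hi ih =>
    obtain ⟨e', he'⟩ := exists_isProj (K := K) U
    obtain rfl := he.eq (he'.insert i)
    refine ((tsiPrime_iff.1 hP).2 (idemS K n i) e' fun s => ?_).elim (fun h => ⟨i, h⟩) (ih he')
    have heA : ∀ g ∈ ({xS K n i, yS K n i} : Set (SnAlg K n)), e' * g = g * e' := by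
      rintro _ (rfl | rfl)
      exacts [he'.commute_xS hi, he'.commute_yS hi]
    refine Submodule.mul_induction_on (mem_centralizer_mul_adjoin i s)
      (fun u hu v hv => ?_) (fun a b ha hb => ?_)
    · have hu' := (Subalgebra.mem_centralizer_iff K).1 hu
      have h1 : Commute (idemS K n i) u :=
        commute_one_sub_mul (R := SnAlg K n) (x := xS K n i) (y := yS K n i)
          (hu' _ (Set.mem_insert _ _)) (hu' _ (Set.mem_insert_of_mem _ rfl))
      have h2 : v * e' = e' * v := by
        refine (Algebra.adjoin_induction (p := fun v _ => Commute e' v) heA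
          (fun c => (Algebra.commutes c e').symm) (fun _ _ _ _ => Commute.add_right)
          (fun _ _ _ _ => Commute.mul_right) hv).symm
      have : idemS K n i * (u * v) * e' = u * (idemS K n i * e') * v := by
        rw [← mul_assoc, h1.eq, mul_assoc, h2]
        simp only [mul_assoc]
      rw [this]
      exact P.mul_mem_right _ _ (P.mul_mem_left _ _ heP)
    · rw [mul_add, add_mul]
      exact P.add_mem ha hb

theorem exists_pIdeal_le {P : TwoSidedIdeal (SnAlg K n)} (hP : tsiPrime P) (h0 : P ≠ ⊥) :
    ∃ i, pIdeal K n i ≤ P := by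
  obtain ⟨e, he⟩ := exists_isProj (K := K) (Finset.univ : Finset (Fin n))
  obtain ⟨i, hi⟩ := exists_idemS_mem hP _ he (isProj_univ_mem h0 he)
  exact ⟨i, TwoSidedIdeal.span_le.2 (by rintro _ rfl; exact hi)⟩

theorem not_pIdeal_le {i j : Fin n} (h : i ≠ j) : ¬ pIdeal K n i ≤ pIdeal K n j := fun hle =>
  idemS_notMem_pIdeal h (hle (idemS_mem_pIdeal i))

theorem bot_lt_pIdeal (i : Fin n) : ⊥ < pIdeal K n i := by
  refine bot_lt_iff_ne_bot.2 fun h => ?_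
  have h1 : idemS K n i = 0 := by
    have := idemS_mem_pIdeal (K := K) i
    rwa [h] at this
  have := coeff_idemS (K := K) i 0 1
  rw [h1] at this
  simp at this

theorem heightIs_pIdeal (i : Fin n) : heightIs (pIdeal K n i) 1 := by
  refine heightIs_one tsiPrime_bot (tsiPrime_pIdeal i) (bot_lt_pIdeal i) fun Q hQ hlt => ?_
  by_contra h0
  obtain ⟨j, hj⟩ := exists_pIdeal_le hQ h0
  by_cases hij : j = i
  · subst hij
    exact hlt.not_ge hj
  · exact not_pIdeal_le hij (hj.trans hlt.le)

theorem eq_pIdeal_of_heightIs_one {P : TwoSidedIdeal (SnAlg K n)} (hP : tsiPrime P)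
    (h : heightIs P 1) : ∃ i, P = pIdeal K n i := by
  have h0 : P ≠ ⊥ := by
    rintro rfl
    obtain ⟨f, hf, -, hlast⟩ := h.1
    exact not_lt_bot (hlast ▸ hf (show (0 : Fin 2) < Fin.last 1 by decide))
  obtain ⟨i, hi⟩ := exists_pIdeal_le hP h0
  exact ⟨i, eq_of_heightIs_one tsiPrime_bot (tsiPrime_pIdeal i) (bot_lt_pIdeal i) hP hi h⟩

theorem pIdeal_injective : Function.Injective (pIdeal K n) := fun i j hij => by
  by_contra h
  exact not_pIdeal_le h hij.le

end OneSidedInverses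

/-- the height-one primes of `S_n` are exactly `p_1, …, p_n`; they are pairwise
distinct and pairwise incomparable, so `S_n` has exactly `n` height-one primes. -/
theorem statement10 (K : Type u) [Field K] (n : ℕ) (hn : 0 < n) :
    (∀ i, tsiPrime (pIdeal K n i) ∧ heightIs (pIdeal K n i) 1) ∧
    (∀ P : TwoSidedIdeal (SnAlg K n), tsiPrime P → heightIs P 1 → ∃ i, P = pIdeal K n i) ∧
    Function.Injective (pIdeal K n) ∧
    (∀ i j, i ≠ j → ¬ pIdeal K n i ≤ pIdeal K n j) ∧
    Set.ncard {P : TwoSidedIdeal (SnAlg K n) | tsiPrime P ∧ heightIs P 1} = n := by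
  have hset : {P : TwoSidedIdeal (SnAlg K n) | tsiPrime P ∧ heightIs P 1} =
      Set.range (pIdeal K n) := by
    ext P
    refine ⟨fun h => ?_, ?_⟩
    · obtain ⟨i, rfl⟩ := eq_pIdeal_of_heightIs_one h.1 h.2
      exact ⟨i, rfl⟩
    · rintro ⟨i, rfl⟩
      exact ⟨tsiPrime_pIdeal i, heightIs_pIdeal i⟩
  refine ⟨fun i => ⟨tsiPrime_pIdeal i, heightIs_pIdeal i⟩,
    fun P => eq_pIdeal_of_heightIs_one, pIdeal_injective, fun i j => not_pIdeal_le, ?_⟩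
  rw [hset, Set.ncard_range_of_injective pIdeal_injective, Nat.card_eq_fintype_card,
    Fintype.card_fin]
end
end

section
/- Let I be a two-sided ideal of the algebra S_n. The following conditions are equivalent: (1) the factor algebra S_n/I is a left Noetherian ring; (2) S_n/I is a right Noetherian ring; (3) S_n/I is a commutative ring; (4) a_n ⊆ I. -/
set_option synthInstance.maxHeartbeats 1000000
set_option maxHeartbeats 1000000

open MvPolynomial

noncomputable section

/-- The ideal `a_n = p_1 + ⋯ + p_n` of `S_n`. -/
def aIdeal (K : Type u) [Field K] (n : ℕ) : TwoSidedIdeal (SnAlg K n) := ⨆ i, pIdeal K n i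

theorem Xop_monomial (K : Type u) [Field K] (n : ℕ) (i : Fin n) (α : Fin n →₀ ℕ) :
    Xop K n i (monomial α 1) = monomial (α + Finsupp.single i 1) 1 := by
  simp [Xop, X, monomial_mul, add_comm]

theorem Yop_monomial (K : Type u) [Field K] (n : ℕ) (i : Fin n) (α : Fin n →₀ ℕ) :
    Yop K n i (monomial α 1) =
      if α i = 0 then 0 else monomial (α - Finsupp.single i 1) (1 : K) := by
  simpa only [Yop, coe_basisMonomials] using (basisMonomials (Fin n) K).constr_basis K
    (fun α => if α i = 0 then 0 else monomial (α - Finsupp.single i 1) (1 : K)) α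

theorem Xop_mul_Xop (K : Type u) [Field K] (n : ℕ) (i j : Fin n) :
    Xop K n i * Xop K n j = Xop K n j * Xop K n i := by
  refine (basisMonomials (Fin n) K).ext fun α => ?_
  simp only [coe_basisMonomials, Module.End.mul_apply, Xop_monomial, add_right_comm]

theorem Yop_mul_Xop_self (K : Type u) [Field K] (n : ℕ) (i : Fin n) :
    Yop K n i * Xop K n i = 1 := by
  refine (basisMonomials (Fin n) K).ext fun α => ?_
  simp [coe_basisMonomials, Xop_monomial, Yop_monomial]

theorem Xop_mul_Yop (K : Type u) [Field K] (n : ℕ) {i j : Fin n} (h : i ≠ j) :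
    Xop K n i * Yop K n j = Yop K n j * Xop K n i := by
  refine (basisMonomials (Fin n) K).ext fun α => ?_
  simp only [coe_basisMonomials, Module.End.mul_apply, Xop_monomial, Yop_monomial,
    Finsupp.add_apply, Finsupp.single_eq_of_ne h.symm, add_zero]
  split_ifs with hα
  · simp
  · rw [Xop_monomial, tsub_add_eq_add_tsub]
    simpa [Finsupp.single_le_iff] using Nat.one_le_iff_ne_zero.mpr hα

theorem Yop_mul_Yop (K : Type u) [Field K] (n : ℕ) (i j : Fin n) :
    Yop K n i * Yop K n j = Yop K n j * Yop K n i := by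
  rcases eq_or_ne i j with rfl | h
  · rfl
  refine (basisMonomials (Fin n) K).ext fun α => ?_
  simp only [coe_basisMonomials, Module.End.mul_apply, Yop_monomial]
  by_cases hi : α i = 0 <;> by_cases hj : α j = 0 <;>
    simp [hi, hj, Yop_monomial, Finsupp.single_eq_of_ne h, Finsupp.single_eq_of_ne h.symm,
      tsub_right_comm]

theorem yS_mul_xS_self (K : Type u) [Field K] (n : ℕ) (i : Fin n) : yS K n i * xS K n i = 1 :=
  Subtype.ext (Yop_mul_Xop_self K n i)

theorem adjoin_xS_yS (K : Type u) [Field K] (n : ℕ) :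
    Algebra.adjoin K (Set.range (xS K n) ∪ Set.range (yS K n)) = ⊤ := by
  refine Eq.trans ?_ (Algebra.adjoin_adjoin_coe_preimage
    (s := Set.range (Xop K n) ∪ Set.range (Yop K n)))
  congr 1
  ext a
  change _ ↔ (a : Module.End K (PolyAlg K n)) ∈ Set.range (Xop K n) ∪ Set.range (Yop K n)
  simp [xS, yS, Subtype.ext_iff]

instance (K : Type u) [Field K] (n : ℕ) : Algebra.FiniteType K (SnAlg K n) :=
  ⟨Subalgebra.fg_def.mpr
    ⟨_, (Set.finite_range _).union (Set.finite_range _), adjoin_xS_yS K n⟩⟩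

theorem aIdeal_le_iff (K : Type u) [Field K] (n : ℕ) (I : TwoSidedIdeal (SnAlg K n)) :
    aIdeal K n ≤ I ↔ ∀ i, I.ringCon.mk' (xS K n i) * I.ringCon.mk' (yS K n i) = 1 := by
  simp only [aIdeal, pIdeal, iSup_le_iff, TwoSidedIdeal.span_le, Set.singleton_subset_iff,
    SetLike.mem_coe]
  refine forall_congr' fun i => ?_
  rw [← TwoSidedIdeal.rel_iff, ← map_mul, ← map_one I.ringCon.mk', eq_comm]
  exact (RingCon.eq _).symm

theorem aIdeal_le_of_isDedekindFiniteMonoid (K : Type u) [Field K] (n : ℕ)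
    (I : TwoSidedIdeal (SnAlg K n)) [IsDedekindFiniteMonoid I.ringCon.Quotient] :
    aIdeal K n ≤ I :=
  (aIdeal_le_iff K n I).mpr fun i => mul_eq_one_symm <| by
    rw [← map_mul, yS_mul_xS_self, map_one]

theorem quotient_mul_comm (K : Type u) [Field K] (n : ℕ) {I : TwoSidedIdeal (SnAlg K n)}
    (h : aIdeal K n ≤ I) (a b : I.ringCon.Quotient) : a * b = b * a := by
  rw [aIdeal_le_iff] at h
  let f : SnAlg K n →ₐ[K] I.ringCon.Quotient :=
    { I.ringCon.mk' with commutes' := fun _ => rfl }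
  have hf : Function.Surjective f := RingCon.mk'_surjective I.ringCon
  have hxy (i) : f (xS K n i) * f (yS K n i) = f (yS K n i) * f (xS K n i) :=
    (h i).trans (by rw [← map_mul, yS_mul_xS_self, map_one])
  have hx_y (i j) : f (xS K n i) * f (yS K n j) = f (yS K n j) * f (xS K n i) := by
    rcases eq_or_ne i j with rfl | hij
    · exact hxy i
    · rw [← map_mul, ← map_mul]
      exact congrArg f (Subtype.ext (Xop_mul_Yop K n hij))
  have hgen : ∀ s ∈ Set.range (xS K n) ∪ Set.range (yS K n),
      ∀ t ∈ Set.range (xS K n) ∪ Set.range (yS K n), Commute (f s) (f t) := by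
    rintro _ (⟨i, rfl⟩ | ⟨i, rfl⟩) _ (⟨j, rfl⟩ | ⟨j, rfl⟩)
    · exact Commute.map (Subtype.ext (Xop_mul_Xop K n i j)) f
    · exact hx_y i j
    · exact (hx_y j i).symm
    · exact Commute.map (Subtype.ext (Yop_mul_Yop K n i j)) f
  have htop : Algebra.adjoin K (f '' (Set.range (xS K n) ∪ Set.range (yS K n))) = ⊤ := by
    rw [← AlgHom.map_adjoin, adjoin_xS_yS, Algebra.map_top, AlgHom.range_eq_top]
    exact hf
  refine Algebra.commute_of_mem_adjoin_of_forall_mem_commute (R := K) (htop ▸ Algebra.mem_top) ?_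
  rintro _ ⟨t, ht, rfl⟩
  refine (Algebra.commute_of_mem_adjoin_of_forall_mem_commute (R := K)
    (htop ▸ Algebra.mem_top) ?_).symm
  rintro _ ⟨s, hs, rfl⟩
  exact hgen t ht s hs

theorem isNoetherianRing_quotient_of_mul_comm (K : Type u) [Field K] (n : ℕ)
    {I : TwoSidedIdeal (SnAlg K n)} (h : ∀ a b : I.ringCon.Quotient, a * b = b * a) :
    IsNoetherianRing I.ringCon.Quotient ∧ IsNoetherianRing (I.ringCon.Quotient)ᵐᵒᵖ := by
  let f : SnAlg K n →ₐ[K] I.ringCon.Quotient :=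
    { I.ringCon.mk' with commutes' := fun _ => rfl }
  have hfin : Algebra.FiniteType K I.ringCon.Quotient :=
    Algebra.FiniteType.of_surjective f (RingCon.mk'_surjective I.ringCon)
  let _ : CommRing I.ringCon.Quotient := { (inferInstance : Ring I.ringCon.Quotient) with
    mul_comm := h }
  have hN : IsNoetherianRing I.ringCon.Quotient := Algebra.FiniteType.isNoetherianRing K _
  exact ⟨hN, isNoetherianRing_of_ringEquiv _ (RingEquiv.toOpposite I.ringCon.Quotient)⟩

/-- for a two-sided ideal `I` of `S_n`, the factor ring `S_n/I` is left
Noetherian iff it is right Noetherian iff it is commutative iff `a_n ⊆ I`. -/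
theorem statement12 (K : Type u) [Field K] (n : ℕ) (hn : 0 < n)
    (I : TwoSidedIdeal (SnAlg K n)) :
    (IsNoetherianRing I.ringCon.Quotient ↔ aIdeal K n ≤ I) ∧
    (IsNoetherianRing (I.ringCon.Quotient)ᵐᵒᵖ ↔ aIdeal K n ≤ I) ∧
    ((∀ a b : I.ringCon.Quotient, a * b = b * a) ↔ aIdeal K n ≤ I) := by
  have hle (h : aIdeal K n ≤ I) :=
    isNoetherianRing_quotient_of_mul_comm K n (quotient_mul_comm K n h)
  refine ⟨⟨fun _ => aIdeal_le_of_isDedekindFiniteMonoid K n I, fun h => (hle h).1⟩,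
    ⟨fun _ => ?_, fun h => (hle h).2⟩, ⟨fun h => ?_, quotient_mul_comm K n⟩⟩
  · have := MulOpposite.isDedekindFiniteMonoid_iff.mp
      (inferInstance : IsDedekindFiniteMonoid (I.ringCon.Quotient)ᵐᵒᵖ)
    exact aIdeal_le_of_isDedekindFiniteMonoid K n I
  · have : IsDedekindFiniteMonoid I.ringCon.Quotient := ⟨fun {a b} hab => (h b a).trans hab⟩
    exact aIdeal_le_of_isDedekindFiniteMonoid K n I
end
end

section
/- The polynomial algebra P_n, regarded as a left S_n-module via the inclusion S_n ⊆ End_K(P_n), is a simple S_n-module (its only S_n-submodules are 0 and P_n) and a faithful S_n-module (only 0 ∈ S_n annihilates all of P_n). -/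
set_option synthInstance.maxHeartbeats 1000000
set_option maxHeartbeats 1000000

open MvPolynomial

noncomputable section

/-- The left `S_n`-module structure on `P_n`, via the inclusion `S_n ⊆ End_K(P_n)`. -/
noncomputable instance polyModule (K : Type u) [Field K] (n : ℕ) :
    Module (SnAlg K n) (PolyAlg K n) :=
  Module.compHom _ (SnAlg K n).val.toRingHom

theorem coeff_Yop (K : Type u) [Field K] (n : ℕ) (i : Fin n) (p : PolyAlg K n) (β : Fin n →₀ ℕ) :
    coeff β (Yop K n i p) = coeff (β + Finsupp.single i 1) p := by
  classical
  suffices h : lcoeff K β ∘ₗ Yop K n i = lcoeff K (β + Finsupp.single i 1) from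
    LinearMap.congr_fun h p
  refine (basisMonomials (Fin n) K).ext fun α => ?_
  rw [LinearMap.comp_apply, Yop, Module.Basis.constr_basis, coe_basisMonomials, lcoeff_apply,
    lcoeff_apply, coeff_monomial]
  split_ifs with h0 h1 h1
  · simp [h1] at h0
  · simp
  · simp [h1]
  · rw [coeff_monomial, if_neg]
    rintro rfl
    exact h1 (tsub_add_cancel_of_le
      (Finsupp.single_le_iff.2 (Nat.one_le_iff_ne_zero.2 h0))).symm

theorem exists_mem_coeff_eq_coeff_add {K : Type u} [Field K] {n : ℕ}
    (N : Submodule (SnAlg K n) (PolyAlg K n)) (α : Fin n →₀ ℕ) :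
    ∀ p ∈ N, ∃ q ∈ N, ∀ β, coeff β q = coeff (β + α) p := by
  induction α using Finsupp.induction_linear with
  | zero => exact fun p hp => ⟨p, hp, by simp⟩
  | add α α' h h' =>
    intro p hp
    obtain ⟨q, hq, hqp⟩ := h p hp
    obtain ⟨r, hr, hrq⟩ := h' q hq
    exact ⟨r, hr, fun β => by rw [hrq, hqp, add_assoc, add_comm α]⟩
  | single i m =>
    induction m with
    | zero => exact fun p hp => ⟨p, hp, by simp⟩
    | succ m ih =>
      intro p hp
      obtain ⟨q, hq, hqp⟩ := ih p hp
      refine ⟨yS K n i • q, N.smul_mem _ hq, fun β => ?_⟩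
      rw [Finsupp.single_add, add_comm (Finsupp.single i m), ← add_assoc, ← hqp]
      exact coeff_Yop K n i q β

theorem C_mul_mem {K : Type u} [Field K] {n : ℕ} (N : Submodule (SnAlg K n) (PolyAlg K n))
    (a : K) {p : PolyAlg K n} (hp : p ∈ N) : C a * p ∈ N := by
  rw [← smul_eq_C_mul]
  exact N.smul_mem (algebraMap K (SnAlg K n) a) hp

theorem one_mem_of_ne_bot {K : Type u} [Field K] {n : ℕ}
    {N : Submodule (SnAlg K n) (PolyAlg K n)} (hN : N ≠ ⊥) : (1 : PolyAlg K n) ∈ N := by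
  obtain ⟨p, hp, hp0⟩ := N.exists_mem_ne_zero_of_ne_bot hN
  obtain ⟨α, hα, hmax⟩ := p.support.exists_max_image Finsupp.degree (support_nonempty.2 hp0)
  obtain ⟨q, hq, hqp⟩ := exists_mem_coeff_eq_coeff_add N α p hp
  have hqC : q = C (coeff α p) := by
    classical
    ext β
    rw [hqp, coeff_C]
    split_ifs with h
    · rw [← h, zero_add]
    · by_contra hne
      have hle := hmax _ (mem_support_iff.2 hne)
      rw [map_add] at hle
      exact h ((Finsupp.degree_eq_zero_iff β).1 (by omega)).symm
  have := C_mul_mem N (coeff α p)⁻¹ hq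
  rwa [hqC, ← C_mul, inv_mul_cancel₀ (mem_support_iff.1 hα), C_1] at this

theorem eq_top_of_one_mem {K : Type u} [Field K] {n : ℕ}
    {N : Submodule (SnAlg K n) (PolyAlg K n)} (h1 : (1 : PolyAlg K n) ∈ N) : N = ⊤ := by
  refine (Submodule.eq_top_iff').2 fun p => ?_
  induction p using MvPolynomial.induction_on with
  | C a => simpa using C_mul_mem N a h1
  | add p q hp hq => exact N.add_mem hp hq
  | mul_X p i hp =>
    rw [mul_comm]
    exact N.smul_mem (xS K n i) hp

/-- `P_n` is a simple and faithful left `S_n`-module. -/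
theorem statement15 (K : Type u) [Field K] (n : ℕ) (hn : 0 < n) :
    IsSimpleModule (SnAlg K n) (PolyAlg K n) ∧
    ∀ r : SnAlg K n, (∀ p : PolyAlg K n, r • p = 0) → r = 0 := by
  refine ⟨?_, fun r hr => Subtype.ext (LinearMap.ext hr)⟩
  rw [isSimpleModule_iff]
  exact
    { exists_pair_ne := ⟨⊥, ⊤, bot_ne_top⟩
      eq_bot_or_eq_top := fun N =>
        or_iff_not_imp_left.2 fun hN => eq_top_of_one_mem (one_mem_of_ne_bot hN) }
end
end
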